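/- (Gaussian integration over internal vertices.) Let G be a Feynman graph such that every connected component of G contains an external vertex and V_int ≠ ∅. Then for every α ∈ (0,∞)^E and every x = (x_v)_{v ∈ V_ext} ∈ (ℝ^d)^{V_ext}, Ψ̃_G(α) > 0 and ∫_{(ℝ^d)^{V_int}} ∏_{v ∈ V_int} (d^d x_v / π^{d/2}) exp( − Σ_{e ∈ E} α_e ‖x_{u(e)} − x_{w(e)}‖² ) = Ψ̃_G(α)^{−d/2} · exp( − Φ̃_G(α, x) / Ψ̃_G(α) ). -/

import Mathlib

open scoped Classical ENNReal
open MeasureTheory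

noncomputable section

/-- A Feynman graph with vertices `Fin nV`, edges `Fin nE` (each edge has two
distinct endpoints, multiple edges allowed), a set of external vertices and
real edge weights. -/
structure FeynmanGraph (nV nE : ℕ) where
  ends : Fin nE → Fin nV × Fin nV
  ends_ne : ∀ e, (ends e).1 ≠ (ends e).2
  ext : Finset (Fin nV)
  ν : Fin nE → ℝ

/-- `λ = d/2 - 1`. -/
def lam (d : ℕ) : ℝ := (d : ℝ) / 2 - 1

namespace FeynmanGraph

variable {nV nE : ℕ} (G : FeynmanGraph nV nE)

/-- The edge `e` is incident to the vertex `v`. -/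
def Incident (e : Fin nE) (v : Fin nV) : Prop :=
  (G.ends e).1 = v ∨ (G.ends e).2 = v

/-- The edge `e` joins the vertices `u` and `v`. -/
def Joins (e : Fin nE) (u v : Fin nV) : Prop :=
  G.ends e = (u, v) ∨ G.ends e = (v, u)

/-- The internal vertices of `G`. -/
def intVerts : Finset (Fin nV) := Finset.univ.filter (fun v => v ∉ G.ext)

/-- The simple graph on the vertices of `G` induced by a subset `F` of the edges. -/
def edgeGraph (F : Finset (Fin nE)) : SimpleGraph (Fin nV) :=
  SimpleGraph.fromRel (fun u v => ∃ e ∈ F, G.Joins e u v)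

/-- `F` is a spanning forest of `G` compatible with the collection `p` of pairwise
disjoint vertex sets: `F` is acyclic (as a set of multigraph edges), the graph
`(V, F)` has exactly `p.card` connected components, and distinct parts of `p` lie in
distinct components.  (Acyclicity together with the component count is expressed by
the edge count `F.card + p.card = nV`.) -/
def IsForest (p : Finset (Finset (Fin nV))) (F : Finset (Fin nE)) : Prop :=
  F.card + p.card = nV ∧
  Nat.card (G.edgeGraph F).ConnectedComponent = p.card ∧
  (∀ P ∈ p, ∀ u ∈ P, ∀ v ∈ P, (G.edgeGraph F).Reachable u v) ∧
  (∀ P ∈ p, ∀ Q ∈ p, P ≠ Q → ∀ u ∈ P, ∀ v ∈ Q, ¬ (G.edgeGraph F).Reachable u v)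

/-- The set `𝓕_G^p` of spanning forests compatible with `p`. -/
def forests (p : Finset (Finset (Fin nV))) : Finset (Finset (Fin nE)) :=
  Finset.univ.filter (fun F => G.IsForest p F)

/-- The dual spanning forest polynomial `Ψ̃_G^p`, evaluated at `α`. -/
def dualForestPoly (p : Finset (Finset (Fin nV))) (α : Fin nE → ℝ) : ℝ :=
  ∑ F ∈ G.forests p, ∏ e ∈ F, α e

/-- The spanning forest polynomial `Ψ_G^p`, evaluated at `α`. -/
def forestPoly (p : Finset (Finset (Fin nV))) (α : Fin nE → ℝ) : ℝ :=
  ∑ F ∈ G.forests p, ∏ e ∈ Finset.univ \ F, α e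

/-- The partition of the external vertices into singletons. -/
def singlePart : Finset (Finset (Fin nV)) := G.ext.image (fun v => {v})

/-- The collection `p(i,j)` consisting of `{i, j}` together with the singletons of the
remaining external vertices. -/
def pairPart (i j : Fin nV) : Finset (Finset (Fin nV)) :=
  insert ({i, j} : Finset (Fin nV)) (((G.ext.erase i).erase j).image (fun v => {v}))

/-- `Ψ̃_G`, evaluated at `α`. -/
def psiTilde (α : Fin nE → ℝ) : ℝ := G.dualForestPoly G.singlePart α

/-- `Φ̃_G(α, x) = Σ_{i<j external} ‖x_i - x_j‖² Ψ̃_G^{p(i,j)}(α)`. -/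
def phiTilde {d : ℕ} (x : Fin nV → EuclideanSpace ℝ (Fin d)) (α : Fin nE → ℝ) : ℝ :=
  ∑ i ∈ G.ext, ∑ j ∈ G.ext.filter (fun j => i < j),
    ‖x i - x j‖ ^ 2 * G.dualForestPoly (G.pairPart i j) α

/-- Positions of all vertices: external vertices are placed according to `x`,
internal vertices according to `y`. -/
def assemble {E : Type*} (x : Fin nV → E) (y : {v : Fin nV // v ∉ G.ext} → E) :
    Fin nV → E :=
  fun v => if h : v ∉ G.ext then y ⟨v, h⟩ else x v

/-- The position space Feynman integral
`f_G(x) = ∫ ∏_{v internal} d^d x_v/π^{d/2} ∏_e ‖x_{u(e)} - x_{w(e)}‖^{-2λν_e}`,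
a Lebesgue integral of a nonnegative function, with values in `[0,∞]`.  Only the
external components of `x` matter. -/
def posIntegral (d : ℕ) (x : Fin nV → EuclideanSpace ℝ (Fin d)) : ℝ≥0∞ :=
  (∫⁻ y : {v : Fin nV // v ∉ G.ext} → EuclideanSpace ℝ (Fin d),
      ENNReal.ofReal (∏ e,
        ‖G.assemble x y (G.ends e).1 - G.assemble x y (G.ends e).2‖ ^ (-(2 * lam d * G.ν e)))) /
    ENNReal.ofReal (Real.pi ^ ((d : ℝ) / 2 * (G.intVerts.card : ℝ)))

/-- The standard positions of the three external vertices `0`, `1`, `z`. -/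
def extPos (d : ℕ) (v0 v1 vz : Fin nV) (z : ℂ) : Fin nV → EuclideanSpace ℝ (Fin d) :=
  fun v =>
    if v = v0 then 0
    else if v = v1 then WithLp.toLp 2 (fun i : Fin d => if (i : ℕ) = 0 then 1 else 0)
    else if v = vz then
      WithLp.toLp 2 (fun i : Fin d => if (i : ℕ) = 0 then z.re else if (i : ℕ) = 1 then z.im else 0)
    else 0

/-- The graphical function `f_G(z)` of a graph with the three external vertices
`v0`, `v1`, `vz`. -/
def graphicalFn (d : ℕ) (v0 v1 vz : Fin nV) (z : ℂ) : ℝ≥0∞ :=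
  G.posIntegral d (extPos d v0 v1 vz z)

/-- The edges of `G` having both endpoints in `Vg`. -/
def edgesWithin (Vg : Finset (Fin nV)) : Finset (Fin nE) :=
  Finset.univ.filter (fun e => (G.ends e).1 ∈ Vg ∧ (G.ends e).2 ∈ Vg)

/-- Ultraviolet convergence. -/
def UVConvergent (d : ℕ) : Prop :=
  ∀ Vg : Finset (Fin nV), 2 ≤ Vg.card → (Vg ∩ G.ext).card ≤ 1 →
    lam d * ∑ e ∈ G.edgesWithin Vg, G.ν e < (d : ℝ) / 2 * ((Vg.card : ℝ) - 1)

/-- `(Vg, Eg)` is a subgraph of `G`. -/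
def IsSubgraph (Vg : Finset (Fin nV)) (Eg : Finset (Fin nE)) : Prop :=
  ∀ e ∈ Eg, (G.ends e).1 ∈ Vg ∧ (G.ends e).2 ∈ Vg

/-- `v` is a `g`-internal vertex of the subgraph `g = (Vg, Eg)`. -/
def GInternal (Vg : Finset (Fin nV)) (Eg : Finset (Fin nE)) (v : Fin nV) : Prop :=
  v ∉ G.ext ∧ v ∈ Vg ∧ ∀ e, G.Incident e v → e ∈ Eg

/-- The set of `g`-internal vertices of the subgraph `g = (Vg, Eg)`. -/
def gInternalSet (Vg : Finset (Fin nV)) (Eg : Finset (Fin nE)) : Finset (Fin nV) :=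
  Finset.univ.filter (fun v => G.GInternal Vg Eg v)

/-- Infrared convergence. -/
def IRConvergent (d : ℕ) : Prop :=
  ∀ Vg : Finset (Fin nV), ∀ Eg : Finset (Fin nE), G.IsSubgraph Vg Eg →
    0 < (G.gInternalSet Vg Eg).card →
    (∀ e ∈ Eg, G.GInternal Vg Eg (G.ends e).1 ∨ G.GInternal Vg Eg (G.ends e).2) →
    (d : ℝ) / 2 * ((G.gInternalSet Vg Eg).card : ℝ) < lam d * ∑ e ∈ Eg, G.ν e

/-- The superficial degree of divergence `M_G = λ ν_G - (d/2)·V_int`. -/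
def Mdeg (d : ℕ) : ℝ := lam d * ∑ e, G.ν e - (d : ℝ) / 2 * (G.intVerts.card : ℝ)

end FeynmanGraph


theorem lintegral_exp_neg_sum_sq {ι : Type*} [Fintype ι] :
    ∫⁻ y : ι → ℝ, ENNReal.ofReal (Real.exp (-∑ i, y i ^ 2)) =
      ENNReal.ofReal (Real.pi ^ ((Fintype.card ι : ℝ) / 2)) := by
  have h1 : ∀ y : ι → ℝ, Real.exp (-∑ i, y i ^ 2) = ∏ i, Real.exp (-1 * y i ^ 2) := fun y => by
    rw [← Real.exp_sum, ← Finset.sum_neg_distrib]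
    simp
  simp_rw [h1]
  have h2 : Integrable fun y : ι → ℝ => ∏ i, Real.exp (-1 * y i ^ 2) :=
    Integrable.fintype_prod fun _ => integrable_exp_neg_mul_sq one_pos
  rw [← ofReal_integral_eq_lintegral_ofReal h2
    (Filter.Eventually.of_forall fun y => Finset.prod_nonneg fun i _ => (Real.exp_pos _).le),
    integral_fintype_prod_volume_eq_pow (fun t : ℝ => Real.exp (-1 * t ^ 2)), integral_gaussian,
    div_one, Real.sqrt_eq_rpow, ← Real.rpow_natCast, ← Real.rpow_mul Real.pi_pos.le]
  ring_nf

open scoped MatrixOrder in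
theorem Matrix.PosDef.lintegral_exp_neg {ι : Type*} [Fintype ι] [DecidableEq ι]
    {A : Matrix ι ι ℝ} (hA : A.PosDef) :
    ∫⁻ y : ι → ℝ, ENNReal.ofReal (Real.exp (-(y ⬝ᵥ A.mulVec y))) =
      ENNReal.ofReal (A.det ^ (-(1 / 2) : ℝ) * Real.pi ^ ((Fintype.card ι : ℝ) / 2)) := by
  obtain ⟨B, rfl⟩ := CStarAlgebra.nonneg_iff_eq_star_mul_self.mp hA.posSemidef.nonneg
  have hdet : (star B * B).det = B.det ^ 2 := by
    rw [Matrix.det_mul, Matrix.star_eq_conjTranspose, Matrix.det_conjTranspose, star_trivial, sq]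
  have hB : B.det ≠ 0 := fun h => by
    have := hA.det_pos
    rw [hdet, h] at this
    simp at this
  have hq : ∀ y : ι → ℝ, y ⬝ᵥ (star B * B).mulVec y = ∑ i, (Matrix.toLin' B y) i ^ 2 := fun y => by
    rw [← Matrix.mulVec_mulVec, Matrix.dotProduct_mulVec, Matrix.star_eq_conjTranspose,
      Matrix.vecMul_conjTranspose, star_trivial, star_trivial]
    simp [dotProduct, sq]
  simp_rw [hq]
  have hm : Measurable (Matrix.toLin' B) := (LinearMap.continuous_of_finiteDimensional _).measurable
  rw [← lintegral_map (f := fun z : ι → ℝ => ENNReal.ofReal (Real.exp (-∑ i, z i ^ 2)))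
    (by fun_prop) hm, Real.map_matrix_volume_pi_eq_smul_volume_pi hB, lintegral_smul_measure,
    lintegral_exp_neg_sum_sq, smul_eq_mul, ← ENNReal.ofReal_mul (abs_nonneg _), hdet,
    Real.rpow_neg (sq_nonneg _), ← Real.sqrt_eq_rpow, Real.sqrt_sq_eq_abs, abs_inv]

theorem volume_preserving_curry (ι κ : Type*) [Fintype ι] [Fintype κ] :
    MeasurePreserving (MeasurableEquiv.curry ι κ ℝ) := by
  refine MeasurePreserving.symm (MeasurableEquiv.curry ι κ ℝ).symm
    ⟨MeasurableEquiv.measurable _, ?_⟩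
  symm
  refine Measure.pi_eq fun s hs => ?_
  rw [MeasurableEquiv.map_apply]
  have : (MeasurableEquiv.curry ι κ ℝ).symm ⁻¹' Set.univ.pi s =
      Set.univ.pi fun i => Set.univ.pi fun k => s (i, k) := by
    ext y
    simp [Set.mem_pi, MeasurableEquiv.coe_curry_symm]
  rw [this, volume_pi_pi]
  simp_rw [volume_pi_pi]
  rw [Fintype.prod_prod_type]

open scoped Kronecker in
theorem Matrix.PosDef.lintegral_exp_neg_euclideanSpace {ι : Type*} [Fintype ι] [DecidableEq ι]
    {A : Matrix ι ι ℝ} (hA : A.PosDef) (d : ℕ) :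
    ∫⁻ y : ι → EuclideanSpace ℝ (Fin d),
        ENNReal.ofReal (Real.exp (-∑ k, (fun v => y v k) ⬝ᵥ A.mulVec fun v => y v k)) =
      ENNReal.ofReal (A.det ^ (-((d : ℝ) / 2)) *
        Real.pi ^ ((d : ℝ) / 2 * (Fintype.card ι : ℝ))) := by
  have hmp : MeasurePreserving (fun (z : ι × Fin d → ℝ) (v : ι) =>
      WithLp.toLp 2 (Function.curry z v)) :=
    (volume_preserving_pi fun _ : ι => PiLp.volume_preserving_toLp (Fin d)).comp
      (volume_preserving_curry ι (Fin d))
  have hq : ∀ z : ι × Fin d → ℝ,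
      ∑ k, (fun v => z (v, k)) ⬝ᵥ A.mulVec (fun v => z (v, k)) =
        z ⬝ᵥ (A ⊗ₖ (1 : Matrix (Fin d) (Fin d) ℝ)).mulVec z := fun z => by
    simp only [dotProduct, Matrix.mulVec, Fintype.sum_prod_type, Matrix.kroneckerMap_apply,
      Matrix.one_apply, mul_ite, mul_one, mul_zero, ite_mul, zero_mul]
    rw [Finset.sum_comm]
    simp
  rw [← hmp.lintegral_comp]
  · simp only [Function.curry_apply, hq]
    rw [(hA.kronecker Matrix.PosDef.one).lintegral_exp_neg, Matrix.det_kronecker, Matrix.det_one,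
      one_pow, mul_one, ← Real.rpow_natCast, ← Real.rpow_mul hA.det_pos.le]
    simp only [Fintype.card_prod, Fintype.card_fin]
    push_cast
    ring_nf
  · simp only [dotProduct, Matrix.mulVec]
    fun_prop

namespace FeynmanGraph

variable {nV nE : ℕ} (G : FeynmanGraph nV nE)

/-- The endpoint of `e` opposite to `v`. -/
def other (e : Fin nE) (v : Fin nV) : Fin nV :=
  if (G.ends e).1 = v then (G.ends e).2 else (G.ends e).1

/-- The edges incident to `v`. -/
def star (v : Fin nV) : Finset (Fin nE) := Finset.univ.filter fun e => G.Incident e v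

/-- The choices of an incident edge at every vertex outside `X`. -/
def outFns (X : Finset (Fin nV)) : Finset (Fin nV → Option (Fin nE)) :=
  Fintype.piFinset fun v => if v ∈ X then {none} else (G.star v).image some

/-- Follow the chosen edge at `v`, if there is one. -/
def step (f : Fin nV → Option (Fin nE)) (v : Fin nV) : Fin nV :=
  (f v).elim v fun e => G.other e v

/-- Following the chosen edges from `u`, one arrives at `w`. -/
def Leads (f : Fin nV → Option (Fin nE)) (u w : Fin nV) : Prop := ∃ n, (G.step f)^[n] u = w

/-- Following the chosen edges, one arrives in `X` from everywhere. -/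
def Rooted (X : Finset (Fin nV)) (f : Fin nV → Option (Fin nE)) : Prop :=
  ∀ v, ∃ j ∈ X, G.Leads f v j

/-- The choices of edges that form a forest oriented towards the root set `X`. -/
def rootedFns (X : Finset (Fin nV)) : Finset (Fin nV → Option (Fin nE)) :=
  (G.outFns X).filter (G.Rooted X)

/-- The set of chosen edges. -/
def chosen (f : Fin nV → Option (Fin nE)) : Finset (Fin nE) :=
  Finset.univ.filter fun e => ∃ v, f v = some e

/-- The product of the weights of the chosen edges. -/
def weight (α : Fin nE → ℝ) (f : Fin nV → Option (Fin nE)) : ℝ := ∏ v, (f v).elim 1 α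

variable {G}

theorem mem_star {e : Fin nE} {v : Fin nV} : e ∈ G.star v ↔ G.Incident e v := by simp [star]

theorem mem_outFns {X : Finset (Fin nV)} {f : Fin nV → Option (Fin nE)} :
    f ∈ G.outFns X ↔
      (∀ v ∈ X, f v = none) ∧ ∀ v ∉ X, ∃ e, G.Incident e v ∧ f v = some e := by
  simp only [outFns, Fintype.mem_piFinset]
  constructor
  · intro h
    refine ⟨fun v hv => by simpa [hv] using h v, fun v hv => ?_⟩
    have := h v
    simp only [hv, if_false, Finset.mem_image, mem_star] at this
    obtain ⟨e, he, h'⟩ := this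
    exact ⟨e, he, h'.symm⟩
  · rintro ⟨h1, h2⟩ v
    by_cases hv : v ∈ X
    · simp [hv, h1 v hv]
    · obtain ⟨e, he, h'⟩ := h2 v hv
      simp [hv, h', mem_star, he]

theorem mem_rootedFns {X : Finset (Fin nV)} {f : Fin nV → Option (Fin nE)} :
    f ∈ G.rootedFns X ↔ f ∈ G.outFns X ∧ G.Rooted X f := by simp [rootedFns]

theorem mem_chosen {f : Fin nV → Option (Fin nE)} {e : Fin nE} :
    e ∈ chosen f ↔ ∃ v, f v = some e := by simp [chosen]

theorem other_eq_of_incident {e : Fin nE} {v w : Fin nV} (hv : G.Incident e v)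
    (hw : G.Incident e w) (h : v ≠ w) : G.other e v = w := by
  unfold other Incident at *
  grind

theorem joins_other {e : Fin nE} {v : Fin nV} (hv : G.Incident e v) :
    G.Joins e v (G.other e v) := by
  unfold other Incident Joins at *
  have : G.ends e = ((G.ends e).1, (G.ends e).2) := rfl
  grind

theorem Joins.incident {e : Fin nE} {v w : Fin nV} (h : G.Joins e v w) :
    G.Incident e v ∧ G.Incident e w := by
  unfold Incident Joins at *
  grind

theorem Joins.ne {e : Fin nE} {v w : Fin nV} (h : G.Joins e v w) : v ≠ w := by
  have := G.ends_ne e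
  unfold Joins at *
  grind

theorem Joins.symm {e : Fin nE} {v w : Fin nV} (h : G.Joins e v w) : G.Joins e w v := Or.symm h

theorem edgeGraph_adj {F : Finset (Fin nE)} {u v : Fin nV} :
    (G.edgeGraph F).Adj u v ↔ ∃ e ∈ F, G.Joins e u v := by
  simp only [edgeGraph, SimpleGraph.fromRel_adj]
  constructor
  · rintro ⟨-, h | ⟨e, he, h⟩⟩
    · exact h
    · exact ⟨e, he, h.symm⟩
  · rintro ⟨e, he, h⟩
    exact ⟨h.ne, Or.inl ⟨e, he, h⟩⟩

section

variable {f : Fin nV → Option (Fin nE)}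

theorem step_of_none {v : Fin nV} (h : f v = none) : G.step f v = v := by simp [step, h]

theorem step_of_some {v : Fin nV} {e : Fin nE} (h : f v = some e) :
    G.step f v = G.other e v := by simp [step, h]

theorem Leads.refl (v : Fin nV) : G.Leads f v v := ⟨0, rfl⟩

theorem Leads.trans {u v w : Fin nV} (h : G.Leads f u v) (h' : G.Leads f v w) :
    G.Leads f u w := by
  obtain ⟨n, rfl⟩ := h
  obtain ⟨m, rfl⟩ := h'
  exact ⟨m + n, Function.iterate_add_apply _ _ _ _⟩

theorem leads_step (v : Fin nV) : G.Leads f v (G.step f v) := ⟨1, rfl⟩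

theorem leads_of_step {v w : Fin nV} (h : G.Leads f (G.step f v) w) : G.Leads f v w :=
  (leads_step v).trans h

theorem Leads.induction {w : Fin nV} {P : Fin nV → Prop} (base : P w)
    (ind : ∀ u, P (G.step f u) → P u) {u : Fin nV} (h : G.Leads f u w) : P u := by
  obtain ⟨n, rfl⟩ := h
  induction n generalizing u with
  | zero => exact base
  | succ n ih => exact ind u (ih base)

theorem Leads.mem_of_step_mem {P : Fin nV → Prop} (hP : ∀ u, P u → P (G.step f u)) {u w : Fin nV}
    (h : G.Leads f u w) (hu : P u) : P w := by
  obtain ⟨n, rfl⟩ := h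
  induction n generalizing u with
  | zero => exact hu
  | succ n ih => exact ih (hP u hu)

theorem Leads.eq_of_none {v w : Fin nV} (hv : f v = none) (h : G.Leads f v w) : w = v :=
  h.mem_of_step_mem (P := fun u => u = v) (fun u hu => by rw [hu, step_of_none hv]) rfl

theorem Leads.of_leads_none {u v j : Fin nV} (hj : f j = none) (h : G.Leads f u j)
    (h' : G.Leads f u v) : G.Leads f v j := by
  refine h'.mem_of_step_mem (P := fun u => G.Leads f u j) (fun u hu => ?_) h
  obtain ⟨n, hn⟩ := hu
  cases n with
  | zero =>
    change u = j at hn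
    subst hn
    rw [step_of_none hj]
    exact Leads.refl _
  | succ n => exact ⟨n, hn⟩

theorem Leads.unique {u j k : Fin nV} (hj : f j = none) (hk : f k = none) (h : G.Leads f u j)
    (h' : G.Leads f u k) : j = k :=
  (h.of_leads_none hj h').eq_of_none hk

/-- A set that is closed under following the chosen edges meets the root set. -/
theorem Rooted.not_mem_of_closed {X : Finset (Fin nV)} (hf : G.Rooted X f) {P : Fin nV → Prop}
    (hP : ∀ u, P u → P (G.step f u)) (hX : ∀ u, P u → u ∉ X) (v : Fin nV) : ¬ P v := by
  intro hv
  obtain ⟨j, hj, h⟩ := hf v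
  exact hX j (h.mem_of_step_mem hP hv) hj

end

section

variable {X : Finset (Fin nV)} {f : Fin nV → Option (Fin nE)}

theorem incident_of_eq_some (hf : f ∈ G.outFns X) {v : Fin nV} {e : Fin nE} (h : f v = some e) :
    G.Incident e v := by
  obtain ⟨h1, h2⟩ := mem_outFns.1 hf
  by_cases hv : v ∈ X
  · simp [h1 v hv] at h
  · obtain ⟨e', he', h'⟩ := h2 v hv
    rw [h] at h'
    cases h'
    exact he'

theorem not_mem_of_eq_some (hf : f ∈ G.outFns X) {v : Fin nV} {e : Fin nE} (h : f v = some e) :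
    v ∉ X := fun hv => by
  rw [(mem_outFns.1 hf).1 v hv] at h
  cases h

theorem eq_of_eq_some (hf : f ∈ G.rootedFns X) {v w : Fin nV} {e : Fin nE} (hv : f v = some e)
    (hw : f w = some e) : v = w := by
  obtain ⟨hfo, hfr⟩ := mem_rootedFns.1 hf
  by_contra hne
  have iv := incident_of_eq_some hfo hv
  have iw := incident_of_eq_some hfo hw
  refine hfr.not_mem_of_closed (P := fun u => u = v ∨ u = w) ?_ ?_ v (Or.inl rfl)
  · rintro u (rfl | rfl)
    · right
      rw [step_of_some hv, other_eq_of_incident iv iw hne]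
    · left
      rw [step_of_some hw, other_eq_of_incident iw iv (Ne.symm hne)]
  · rintro u (rfl | rfl)
    · exact not_mem_of_eq_some hfo hv
    · exact not_mem_of_eq_some hfo hw

/-- The chosen edge at a vertex outside `X`, as a bijection onto the chosen edges. -/
theorem exists_edge (hf : f ∈ G.rootedFns X) :
    ∃ g : ∀ v ∈ Xᶜ, Fin nE, (∀ v hv, f v = some (g v hv)) ∧ (∀ v hv, g v hv ∈ chosen f) ∧
      (∀ v hv w hw, g v hv = g w hw → v = w) ∧ ∀ e ∈ chosen f, ∃ v hv, g v hv = e := by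
  obtain ⟨hfo, hfr⟩ := mem_rootedFns.1 hf
  have h2 := (mem_outFns.1 hfo).2
  choose g hg1 hg2 using h2
  refine ⟨fun v hv => g v (Finset.mem_compl.1 hv), fun v hv => hg2 v _,
    fun v hv => mem_chosen.2 ⟨v, hg2 v _⟩, fun v hv w hw h => ?_, fun e he => ?_⟩
  · exact eq_of_eq_some hf (hg2 v (Finset.mem_compl.1 hv))
      ((hg2 w (Finset.mem_compl.1 hw)).trans (congrArg some h.symm))
  · obtain ⟨v, hv⟩ := mem_chosen.1 he
    refine ⟨v, Finset.mem_compl.2 (not_mem_of_eq_some hfo hv), ?_⟩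
    have := hg2 v (not_mem_of_eq_some hfo hv)
    rw [hv] at this
    exact (Option.some.inj this).symm

theorem card_chosen (hf : f ∈ G.rootedFns X) : (chosen f).card = Xᶜ.card := by
  obtain ⟨g, -, h2, h3, h4⟩ := exists_edge hf
  exact (Finset.card_bij g h2 h3 h4).symm

theorem weight_eq_prod_chosen (α : Fin nE → ℝ) (hf : f ∈ G.rootedFns X) :
    weight α f = ∏ e ∈ chosen f, α e := by
  obtain ⟨g, h1, h2, h3, h4⟩ := exists_edge hf
  rw [← Finset.prod_bij g (f := fun v => (f v).elim 1 α) h2 h3 h4 fun v hv => by simp [h1 v hv]]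
  refine (Finset.prod_subset (Finset.subset_univ _) fun v _ hv => ?_).symm
  rw [(mem_outFns.1 (mem_rootedFns.1 hf).1).1 v (by simpa using hv)]
  rfl

theorem reachable_step (hf : f ∈ G.outFns X) (u : Fin nV) :
    (G.edgeGraph (chosen f)).Reachable u (G.step f u) := by
  cases h : f u with
  | none => rw [step_of_none h]
  | some e =>
    rw [step_of_some h]
    exact SimpleGraph.Adj.reachable (edgeGraph_adj.2
      ⟨e, mem_chosen.2 ⟨u, h⟩, joins_other (incident_of_eq_some hf h)⟩)

theorem Leads.reachable (hf : f ∈ G.outFns X) {u v : Fin nV} (h : G.Leads f u v) :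
    (G.edgeGraph (chosen f)).Reachable u v :=
  h.induction (P := fun u => (G.edgeGraph (chosen f)).Reachable u v)
    (SimpleGraph.Reachable.refl _) fun u hu => (reachable_step hf u).trans hu

theorem step_of_adj (hf : f ∈ G.outFns X) {u v : Fin nV}
    (h : (G.edgeGraph (chosen f)).Adj u v) : G.step f u = v ∨ G.step f v = u := by
  obtain ⟨e, he, hj⟩ := edgeGraph_adj.1 h
  obtain ⟨w, hw⟩ := mem_chosen.1 he
  have iw := incident_of_eq_some hf hw
  obtain ⟨iu, iv⟩ := hj.incident
  by_cases hwu : w = u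
  · subst hwu
    left
    rw [step_of_some hw, other_eq_of_incident iu iv hj.ne]
  · have hwv : w = v := by
      rw [← other_eq_of_incident iu iv hj.ne]
      exact (other_eq_of_incident iu iw (Ne.symm hwu)).symm
    subst hwv
    right
    rw [step_of_some hw, other_eq_of_incident iv iu hj.ne.symm]

theorem leads_iff_of_reachable (hf : f ∈ G.outFns X) {u v j : Fin nV} (hj : j ∈ X)
    (h : (G.edgeGraph (chosen f)).Reachable u v) : G.Leads f u j ↔ G.Leads f v j := by
  have hj' := (mem_outFns.1 hf).1 j hj
  have key : ∀ u, G.Leads f u j ↔ G.Leads f (G.step f u) j := fun u =>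
    ⟨fun hu => hu.of_leads_none hj' (leads_step u), leads_of_step⟩
  obtain ⟨p⟩ := h
  induction p with
  | nil => rfl
  | cons hadj _ ih =>
    refine Iff.trans ?_ ih
    rcases step_of_adj hf hadj with h' | h'
    · rw [← h', ← key]
    · rw [← h', ← key]

theorem reachable_iff_leads (hf : f ∈ G.outFns X) {u j : Fin nV} (hj : j ∈ X) :
    (G.edgeGraph (chosen f)).Reachable u j ↔ G.Leads f u j :=
  ⟨fun h => (leads_iff_of_reachable hf hj h).2 (Leads.refl j), fun h => h.reachable hf⟩

theorem chosen_injOn (X : Finset (Fin nV)) :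
    Set.InjOn chosen (G.rootedFns X : Set (Fin nV → Option (Fin nE))) := by
  intro f hf g hg hfg
  have hf : f ∈ G.rootedFns X := hf
  have hg : g ∈ G.rootedFns X := hg
  obtain ⟨hfo, hfr⟩ := mem_rootedFns.1 hf
  obtain ⟨hgo, hgr⟩ := mem_rootedFns.1 hg
  have hX : ∀ u, f u ≠ g u → u ∉ X := fun u hu hX =>
    hu (by rw [(mem_outFns.1 hfo).1 u hX, (mem_outFns.1 hgo).1 u hX])
  funext v
  by_contra hv
  refine hfr.not_mem_of_closed (P := fun u => f u ≠ g u) (fun u hu => ?_) hX v hv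
  obtain ⟨e, ie, he⟩ := (mem_outFns.1 hfo).2 u (hX u hu)
  have : e ∈ chosen g := hfg ▸ mem_chosen.2 ⟨u, he⟩
  obtain ⟨w, hw⟩ := mem_chosen.1 this
  have hne : u ≠ w := by
    rintro rfl
    exact hu (he.trans hw.symm)
  rw [step_of_some he, other_eq_of_incident ie (incident_of_eq_some hgo hw) hne, hw]
  exact fun h => hne (eq_of_eq_some hf he h)

theorem isForest_image_singleton {X : Finset (Fin nV)} {F : Finset (Fin nE)} :
    G.IsForest (X.image fun v => {v}) F ↔
      F.card = Xᶜ.card ∧ Nat.card (G.edgeGraph F).ConnectedComponent = X.card ∧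
        ∀ u ∈ X, ∀ v ∈ X, (G.edgeGraph F).Reachable u v → u = v := by
  have hc : (X.image fun v => ({v} : Finset (Fin nV))).card = X.card :=
    Finset.card_image_of_injective _ Finset.singleton_injective
  have hX := X.card_compl_add_card
  rw [Fintype.card_fin] at hX
  simp only [IsForest, hc, Finset.forall_mem_image, Finset.mem_singleton, forall_eq]
  constructor
  · rintro ⟨h1, h2, -, h4⟩
    refine ⟨by omega, h2, fun u hu v hv h => ?_⟩
    by_contra hne
    exact h4 hu hv (by simpa using hne) h
  · rintro ⟨h1, h2, h3⟩
    exact ⟨by omega, h2, fun _ _ => SimpleGraph.Reachable.refl _,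
      fun u hu v hv hne h => hne (by rw [h3 u hu v hv h])⟩

theorem isForest_chosen (hf : f ∈ G.rootedFns X) :
    G.IsForest (X.image fun v => {v}) (chosen f) := by
  obtain ⟨hfo, hfr⟩ := mem_rootedFns.1 hf
  have hn := (mem_outFns.1 hfo).1
  have hinj : ∀ u ∈ X, ∀ v ∈ X, (G.edgeGraph (chosen f)).Reachable u v → u = v :=
    fun u hu v hv h => (((reachable_iff_leads hfo hv).1 h).eq_of_none (hn u hu)).symm
  refine isForest_image_singleton.2 ⟨card_chosen hf, ?_, hinj⟩
  have hX : Nat.card X = X.card := by simp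
  rw [← hX]
  symm
  refine Nat.card_eq_of_bijective
    (fun v : X => (G.edgeGraph (chosen f)).connectedComponentMk v) ⟨?_, ?_⟩
  · rintro ⟨u, hu⟩ ⟨v, hv⟩ h
    exact Subtype.ext (hinj u hu v hv (SimpleGraph.ConnectedComponent.exact h))
  · intro c
    induction c using SimpleGraph.ConnectedComponent.ind with
    | h v =>
      obtain ⟨j, hj, h⟩ := hfr v
      exact ⟨⟨j, hj⟩, SimpleGraph.ConnectedComponent.sound (h.reachable hfo).symm⟩

theorem exists_reachable_of_isForest {F : Finset (Fin nE)}
    (hF : G.IsForest (X.image fun v => {v}) F) (v : Fin nV) :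
    ∃ j ∈ X, (G.edgeGraph F).Reachable v j := by
  obtain ⟨-, h2, h3⟩ := isForest_image_singleton.1 hF
  have hinj : Function.Injective fun v : X => (G.edgeGraph F).connectedComponentMk v := by
    rintro ⟨u, hu⟩ ⟨v, hv⟩ h
    exact Subtype.ext (h3 u hu v hv (SimpleGraph.ConnectedComponent.exact h))
  have hbij := (Nat.bijective_iff_injective_and_card _).2 ⟨hinj, by rw [h2]; simp⟩
  obtain ⟨⟨j, hj⟩, h⟩ := hbij.2 ((G.edgeGraph F).connectedComponentMk v)
  exact ⟨j, hj, (SimpleGraph.ConnectedComponent.exact h).symm⟩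

theorem exists_adj_dist_lt {V : Type*} {H : SimpleGraph V} {u v : V} (h : H.Reachable u v)
    (hne : u ≠ v) : ∃ w, H.Adj u w ∧ H.dist w v < H.dist u v := by
  obtain ⟨p, hp⟩ := h.exists_walk_length_eq_dist
  cases p with
  | nil => exact absurd rfl hne
  | cons hadj q =>
    refine ⟨_, hadj, ?_⟩
    rw [← hp, SimpleGraph.Walk.length_cons]
    exact Nat.lt_succ_of_le (SimpleGraph.dist_le q)

theorem exists_rootedFn_of_isForest {F : Finset (Fin nE)}
    (hF : G.IsForest (X.image fun v => {v}) F) : ∃ f ∈ G.rootedFns X, chosen f = F := by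
  obtain ⟨h1, -, h3⟩ := isForest_image_singleton.1 hF
  choose r hrX hr using exists_reachable_of_isForest hF
  have hclose : ∀ v ∉ X, ∃ e ∈ F, G.Incident e v ∧
      (G.edgeGraph F).Reachable v (G.other e v) ∧
      (G.edgeGraph F).dist (G.other e v) (r v) < (G.edgeGraph F).dist v (r v) := by
    intro v hv
    obtain ⟨w, hadj, hlt⟩ := exists_adj_dist_lt (hr v) (fun h => hv (h ▸ hrX v))
    obtain ⟨e, he, hj⟩ := edgeGraph_adj.1 hadj
    have hw := other_eq_of_incident hj.incident.1 hj.incident.2 hj.ne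
    exact ⟨e, he, hj.incident.1, by rw [hw]; exact hadj.reachable, by rw [hw]; exact hlt⟩
  choose g hgF hgi hgr hgd using hclose
  let f : Fin nV → Option (Fin nE) := fun v => if h : v ∈ X then none else some (g v h)
  have hfX : ∀ v ∈ X, f v = none := fun v hv => by simp [f, hv]
  have hfg : ∀ v (hv : v ∉ X), f v = some (g v hv) := fun v hv => by simp [f, hv]
  have hfo : f ∈ G.outFns X := mem_outFns.2 ⟨hfX, fun v hv => ⟨g v hv, hgi v hv, hfg v hv⟩⟩
  have hfr : G.Rooted X f := by
    intro v
    induction hn : (G.edgeGraph F).dist v (r v) using Nat.strong_induction_on generalizing v with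
    | _ n ih =>
      by_cases hv : v ∈ X
      · exact ⟨v, hv, Leads.refl v⟩
      · have hrr : r (G.other (g v hv) v) = r v :=
          h3 _ (hrX _) _ (hrX _) (((hr _).symm.trans (hgr v hv).symm).trans (hr v))
        obtain ⟨j, hj, h⟩ := ih _ (by rw [← hn, hrr]; exact hgd v hv) _ rfl
        exact ⟨j, hj, leads_of_step (by rwa [step_of_some (hfg v hv)])⟩
  have hf := mem_rootedFns.2 ⟨hfo, hfr⟩
  refine ⟨f, hf, Finset.eq_of_subset_of_card_le (fun e he => ?_) (by rw [card_chosen hf, h1])⟩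
  obtain ⟨v, hv⟩ := mem_chosen.1 he
  rw [hfg v (not_mem_of_eq_some hfo hv)] at hv
  rw [← Option.some.inj hv]
  exact hgF v _

theorem sum_forests_filter (G : FeynmanGraph nV nE) (X : Finset (Fin nV))
    (P : Finset (Fin nE) → Prop) (α : Fin nE → ℝ) :
    ∑ F ∈ (G.forests (X.image fun v => {v})).filter P, ∏ e ∈ F, α e =
      ∑ f ∈ (G.rootedFns X).filter fun f => P (chosen f), weight α f := by
  symm
  refine Finset.sum_bij (fun f _ => chosen f) ?_ ?_ ?_ ?_
  · intro f hf
    rw [Finset.mem_filter] at hf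
    simpa [forests, hf.2] using isForest_chosen hf.1
  · intro f hf g hg h
    exact chosen_injOn X (Finset.mem_filter.1 hf).1 (Finset.mem_filter.1 hg).1 h
  · intro F hF
    simp only [forests, Finset.mem_filter, Finset.mem_univ, true_and] at hF
    obtain ⟨f, hf, rfl⟩ := exists_rootedFn_of_isForest hF.1
    exact ⟨f, Finset.mem_filter.2 ⟨hf, hF.2⟩, rfl⟩
  · intro f hf
    exact weight_eq_prod_chosen α (Finset.mem_filter.1 hf).1

end

end FeynmanGraph
namespace FeynmanGraph

variable {nV nE : ℕ} (G : FeynmanGraph nV nE)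

/-- The signed indicator of the endpoints of `e`. -/
def boundary (e : Fin nE) : Fin nV → ℝ :=
  Pi.single (G.ends e).1 1 - Pi.single (G.ends e).2 1

/-- The weighted Laplacian of `G`. -/
def laplacian (α : Fin nE → ℝ) : Matrix (Fin nV) (Fin nV) ℝ :=
  Matrix.of fun v w => ∑ e, α e * (G.boundary e v * G.boundary e w)

/-- The weighted Laplacian with the rows in `X` replaced by those of the identity. -/
def rootedLaplacian (X : Finset (Fin nV)) (α : Fin nE → ℝ) : Matrix (Fin nV) (Fin nV) ℝ :=
  Matrix.of fun v => if v ∈ X then Pi.single v 1 else G.laplacian α v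

/-- The weighted Laplacian restricted to the vertices outside `X`. -/
def reducedLaplacian (X : Finset (Fin nV)) (α : Fin nE → ℝ) :
    Matrix {v : Fin nV // v ∉ X} {v : Fin nV // v ∉ X} ℝ :=
  Matrix.of fun v w => G.laplacian α v w

/-- The row at `v` contributed by a choice of an edge at `v`. -/
def choiceRow (v : Fin nV) (o : Option (Fin nE)) : Fin nV → ℝ :=
  o.elim (Pi.single v 1) fun e => Pi.single v 1 - Pi.single (G.other e v) 1

/-- The matrix of the rows contributed by the choices of edges `f`. -/
def choiceMatrix (f : Fin nV → Option (Fin nE)) : Matrix (Fin nV) (Fin nV) ℝ :=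
  Matrix.of fun v => G.choiceRow v (f v)

variable {G}

theorem boundary_eq_zero {e : Fin nE} {v : Fin nV} (h : ¬ G.Incident e v) :
    G.boundary e v = 0 := by
  unfold Incident at h
  push Not at h
  simp [boundary, h.1.symm, h.2.symm]

theorem boundary_mul_boundary {e : Fin nE} {v : Fin nV} (h : G.Incident e v) (w : Fin nV) :
    G.boundary e v * G.boundary e w = G.choiceRow v (some e) w := by
  have hne := G.ends_ne e
  unfold Incident at h
  simp only [boundary, choiceRow, other, Option.elim, Pi.sub_apply, Pi.single_apply]
  grind

theorem laplacian_row (α : Fin nE → ℝ) (v : Fin nV) :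
    G.laplacian α v = ∑ e ∈ G.star v, α e • G.choiceRow v (some e) := by
  ext w
  simp only [laplacian, Finset.sum_apply, Pi.smul_apply, smul_eq_mul]
  symm
  refine Finset.sum_subset_zero_on_sdiff (Finset.subset_univ _) (fun e he => ?_) fun e he => ?_
  · rw [boundary_eq_zero (by simpa [mem_star] using he)]
    ring
  · rw [boundary_mul_boundary (mem_star.1 he)]

theorem det_rootedLaplacian_eq_sum (X : Finset (Fin nV)) (α : Fin nE → ℝ) :
    (G.rootedLaplacian X α).det =
      ∑ f ∈ G.outFns X, weight α f * (G.choiceMatrix f).det := by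
  have hrow : G.rootedLaplacian X α = Matrix.of fun v => ∑ o ∈ (if v ∈ X then {none} else
      (G.star v).image some : Finset (Option (Fin nE))), o.elim 1 α • G.choiceRow v o := by
    unfold rootedLaplacian
    congr 1
    funext v
    by_cases hv : v ∈ X
    · simp [hv, choiceRow]
    · simp [hv, laplacian_row]
  have hdet : ∀ M : Fin nV → Fin nV → ℝ, (Matrix.of M).det =
      (Matrix.detRowAlternating (R := ℝ) (n := Fin nV)).toMultilinearMap M := fun _ => rfl
  rw [hrow, hdet, MultilinearMap.map_sum_finset]
  refine Finset.sum_congr rfl fun f _ => ?_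
  rw [MultilinearMap.map_smul_univ]
  rfl

theorem choiceRow_eq (f : Fin nV → Option (Fin nE)) (v : Fin nV) :
    G.choiceRow v (f v) =
      Pi.single v 1 - if f v = none then 0 else Pi.single (G.step f v) 1 := by
  cases h : f v <;> simp [choiceRow, step, h]

theorem det_choiceRow_of_rooted {X : Finset (Fin nV)} {f : Fin nV → Option (Fin nE)}
    (hf : f ∈ G.outFns X) (hr : G.Rooted X f) :
    (G.choiceMatrix f).det = 1 := by
  have hex : ∀ v, ∃ n, (G.step f)^[n] v ∈ X := fun v => by
    obtain ⟨j, hj, n, rfl⟩ := hr v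
    exact ⟨n, hj⟩
  have hlt : ∀ v, f v ≠ none → Nat.find (hex (G.step f v)) < Nat.find (hex v) := by
    intro v hv
    have h0 : Nat.find (hex v) ≠ 0 := fun h0 => by
      rw [Nat.find_eq_zero] at h0
      exact hv ((mem_outFns.1 hf).1 v h0)
    obtain ⟨n, hn⟩ := Nat.exists_eq_succ_of_ne_zero h0
    have := Nat.find_spec (hex v)
    rw [hn] at this ⊢
    exact Nat.lt_succ_of_le (Nat.find_min' _ this)
  have hentry : ∀ v w, v ≠ w → Nat.find (hex v) ≤ Nat.find (hex w) →
      G.choiceRow v (f v) w = 0 := by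
    intro v w hne hle
    rw [choiceRow_eq]
    split_ifs with h
    · simp [hne.symm]
    · have : w ≠ G.step f v := by
        rintro rfl
        exact absurd (hlt v h) (not_lt.2 hle)
      simp [hne.symm, this]
  have hdiag : ∀ v, G.choiceRow v (f v) v = 1 := by
    intro v
    rw [choiceRow_eq]
    split_ifs with h
    · simp
    · have : v ≠ G.step f v := fun h' => by
        have := hlt v h
        rw [← h'] at this
        exact lt_irrefl _ this
      simp [this]
  have hbt : (G.choiceMatrix f).BlockTriangular (fun v => OrderDual.toDual (Nat.find (hex v))) :=
      fun v w hvw =>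
    hentry v w (by rintro rfl; exact lt_irrefl _ hvw) (le_of_lt (OrderDual.toDual_lt_toDual.1 hvw))
  rw [hbt.det]
  refine Finset.prod_eq_one fun a _ => ?_
  have hone : (G.choiceMatrix f).toSquareBlock
      (fun v => OrderDual.toDual (Nat.find (hex v))) a = 1 := by
    ext ⟨v, hv⟩ ⟨w, hw⟩
    by_cases h : v = w
    · subst h
      simpa [Matrix.toSquareBlock, Matrix.toSquareBlockProp, choiceMatrix] using hdiag v
    · rw [Matrix.one_apply_ne (by simpa using h)]
      exact hentry v w h (OrderDual.toDual.injective (hv.trans hw.symm)).le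
  rw [hone, Matrix.det_one]

theorem det_choiceRow_of_not_rooted {X : Finset (Fin nV)} {f : Fin nV → Option (Fin nE)}
    (hf : f ∈ G.outFns X) (hr : ¬ G.Rooted X f) :
    (G.choiceMatrix f).det = 0 := by
  unfold Rooted at hr
  push Not at hr
  obtain ⟨v₀, hv₀⟩ := hr
  rw [← Matrix.exists_mulVec_eq_zero_iff]
  refine ⟨fun v => if ∃ j ∈ X, G.Leads f v j then 0 else 1, fun h => ?_, ?_⟩
  · have := congrFun h v₀
    have hn : ¬ ∃ j ∈ X, G.Leads f v₀ j := by push Not; exact hv₀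
    simp [hn] at this
  · ext v
    change G.choiceRow v (f v) ⬝ᵥ _ = 0
    rw [choiceRow_eq, sub_dotProduct, single_one_dotProduct]
    by_cases hv : f v = none
    · have hX : v ∈ X := by
        by_contra hX
        obtain ⟨e, -, he⟩ := (mem_outFns.1 hf).2 v hX
        simp [hv] at he
      have : ∃ j ∈ X, G.Leads f v j := ⟨v, hX, Leads.refl v⟩
      simp [hv, this]
    · rw [if_neg hv, single_one_dotProduct]
      have : (∃ j ∈ X, G.Leads f v j) ↔ ∃ j ∈ X, G.Leads f (G.step f v) j :=
        ⟨fun ⟨j, hj, h⟩ => ⟨j, hj, h.of_leads_none ((mem_outFns.1 hf).1 j hj) (leads_step v)⟩,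
          fun ⟨j, hj, h⟩ => ⟨j, hj, leads_of_step h⟩⟩
      simp only [this]
      ring

theorem det_rootedLaplacian (X : Finset (Fin nV)) (α : Fin nE → ℝ) :
    (G.rootedLaplacian X α).det = ∑ f ∈ G.rootedFns X, weight α f := by
  rw [det_rootedLaplacian_eq_sum, rootedFns, Finset.sum_filter]
  refine Finset.sum_congr rfl fun f hf => ?_
  split_ifs with h
  · rw [det_choiceRow_of_rooted hf h, mul_one]
  · rw [det_choiceRow_of_not_rooted hf h, mul_zero]

theorem det_reducedLaplacian (X : Finset (Fin nV)) (α : Fin nE → ℝ) :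
    (G.reducedLaplacian X α).det = ∑ f ∈ G.rootedFns X, weight α f := by
  rw [← det_rootedLaplacian, Matrix.twoBlockTriangular_det' _ (fun v => v ∈ X)]
  · have h1 : (G.rootedLaplacian X α).toSquareBlockProp (fun v => v ∈ X) = 1 := by
      ext ⟨v, hv⟩ ⟨w, hw⟩
      simp [Matrix.toSquareBlockProp, rootedLaplacian, hv, Matrix.one_apply, Pi.single_apply,
        eq_comm]
    have h2 : (G.rootedLaplacian X α).toSquareBlockProp (fun v => v ∉ X) =
        G.reducedLaplacian X α := by
      ext ⟨v, hv⟩ ⟨w, hw⟩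
      simp [Matrix.toSquareBlockProp, rootedLaplacian, hv, reducedLaplacian]
    rw [h1, h2, @Matrix.det_one _ _ (_) _ _, one_mul]
  · intro v hv w hw
    have : w ≠ v := by
      rintro rfl
      exact hw hv
    simp [rootedLaplacian, hv, this]

theorem psiTilde_eq_sum (α : Fin nE → ℝ) :
    G.psiTilde α = ∑ f ∈ G.rootedFns G.ext, weight α f := by
  have := G.sum_forests_filter G.ext (fun _ => True) α
  simpa [psiTilde, dualForestPoly, singlePart] using this

end FeynmanGraph
namespace FeynmanGraph

variable {nV nE : ℕ} {G : FeynmanGraph nV nE}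

theorem sum_outFns_eq_sum_update {X : Finset (Fin nV)} {v : Fin nV} (hv : v ∉ X)
    (φ : (Fin nV → Option (Fin nE)) → ℝ) :
    ∑ f ∈ G.outFns X, φ f =
      ∑ T ∈ G.outFns (insert v X), ∑ e ∈ G.star v, φ (Function.update T v (some e)) := by
  rw [← Finset.sum_product']
  symm
  refine Finset.sum_bij (fun p _ => Function.update p.1 v (some p.2)) ?_ ?_ ?_ fun _ _ => rfl
  · rintro ⟨T, e⟩ h
    obtain ⟨hT, he⟩ := Finset.mem_product.1 h
    obtain ⟨h1, h2⟩ := mem_outFns.1 hT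
    refine mem_outFns.2 ⟨fun w hw => ?_, fun w hw => ?_⟩
    · have : w ≠ v := by
        rintro rfl
        exact hv hw
      simpa [this] using h1 w (Finset.mem_insert_of_mem hw)
    · by_cases hwv : w = v
      · subst hwv
        exact ⟨e, mem_star.1 he, by simp⟩
      · simpa [hwv] using h2 w (by simp [hwv, hw])
  · rintro ⟨T, e⟩ h ⟨T', e'⟩ h' heq
    obtain ⟨hT, he⟩ := Finset.mem_product.1 h
    obtain ⟨hT', he'⟩ := Finset.mem_product.1 h'
    have hT : T ∈ G.outFns (insert v X) := hT
    have hT' : T' ∈ G.outFns (insert v X) := hT'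
    have key : ∀ w, Function.update T v (some e) w = Function.update T' v (some e') w :=
      congrFun heq
    have hee : e = e' := by simpa using key v
    have hTT : T = T' := by
      funext w
      by_cases hwv : w = v
      · rw [hwv, (mem_outFns.1 hT).1 v (Finset.mem_insert_self _ _),
          (mem_outFns.1 hT').1 v (Finset.mem_insert_self _ _)]
      · simpa [hwv] using key w
    rw [hee, hTT]
  · intro f hf
    obtain ⟨h1, h2⟩ := mem_outFns.1 hf
    obtain ⟨e, he, hfe⟩ := h2 v hv
    refine ⟨(Function.update f v none, e), Finset.mem_product.2 ⟨mem_outFns.2 ⟨?_, ?_⟩,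
      mem_star.2 he⟩, ?_⟩
    · intro w hw
      by_cases hwv : w = v
      · simp [hwv]
      · simpa [hwv] using h1 w (Finset.mem_of_mem_insert_of_ne hw hwv)
    · intro w hw
      have hwv : w ≠ v := fun h => hw (by simp [h])
      simpa [hwv] using h2 w fun h => hw (Finset.mem_insert_of_mem h)
    · simp [← hfe]

theorem weight_update (α : Fin nE → ℝ) {T : Fin nV → Option (Fin nE)} {v : Fin nV}
    (hT : T v = none) (e : Fin nE) :
    weight α (Function.update T v (some e)) = α e * weight α T := by
  unfold weight
  rw [Fintype.prod_eq_mul_prod_compl v, Fintype.prod_eq_mul_prod_compl v, hT]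
  simp only [Function.update_self, Option.elim, one_mul]
  congr 1
  refine Finset.prod_congr rfl fun w hw => ?_
  have : w ≠ v := by simpa using hw
  simp [this]

theorem step_update_of_ne (T : Fin nV → Option (Fin nE)) {u v : Fin nV} (o : Option (Fin nE))
    (h : u ≠ v) : G.step (Function.update T v o) u = G.step T u := by
  simp [step, h]

theorem Leads.update {T : Fin nV → Option (Fin nE)} {v : Fin nV} (hT : T v = none)
    (o : Option (Fin nE)) {u k : Fin nV} (h : G.Leads T u k) :
    G.Leads (Function.update T v o) u k := by
  obtain ⟨n, rfl⟩ := h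
  induction n generalizing u with
  | zero => exact Leads.refl _
  | succ n ih =>
    by_cases huv : u = v
    · subst huv
      rw [Leads.eq_of_none hT ⟨n + 1, rfl⟩]
      exact Leads.refl _
    · refine leads_of_step ?_
      rw [step_update_of_ne T o huv]
      exact ih

theorem Leads.of_update {T : Fin nV → Option (Fin nE)} {v : Fin nV} {o : Option (Fin nE)}
    {u k : Fin nV} (h : G.Leads (Function.update T v o) u k) : G.Leads T u k ∨ G.Leads T u v := by
  refine h.induction (P := fun u => G.Leads T u k ∨ G.Leads T u v)
    (Or.inl (Leads.refl _)) fun u hu => ?_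
  by_cases huv : u = v
  · subst huv
    exact Or.inr (Leads.refl _)
  · rw [step_update_of_ne T o huv] at hu
    exact hu.imp leads_of_step leads_of_step

theorem rooted_update_and_leads_iff {X : Finset (Fin nV)} {v : Fin nV} (hv : v ∉ X)
    {T : Fin nV → Option (Fin nE)} (hT : T ∈ G.outFns (insert v X)) (e : Fin nE)
    {u j : Fin nV} (hj : j ∈ X) :
    (G.Rooted X (Function.update T v (some e)) ∧ G.Leads (Function.update T v (some e)) u j) ↔
      G.Rooted (insert v X) T ∧ ¬ G.Leads T (G.other e v) v ∧
        (G.Leads T u j ∨ (G.Leads T u v ∧ G.Leads T (G.other e v) j)) := by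
  have hTn : ∀ w ∈ insert v X, T w = none := (mem_outFns.1 hT).1
  have hTv : T v = none := hTn v (Finset.mem_insert_self _ _)
  have hne : ∀ k ∈ X, k ≠ v := fun k hk h => hv (h ▸ hk)
  have hfn : ∀ k ∈ X, Function.update T v (some e) k = none := fun k hk => by
    simpa [hne k hk] using hTn k (Finset.mem_insert_of_mem hk)
  have hstep : G.step (Function.update T v (some e)) v = G.other e v := step_of_some (by simp)
  have hnext : ∀ k ∈ X, G.Leads (Function.update T v (some e)) v k →
      G.Leads (Function.update T v (some e)) (G.other e v) k := fun k hk h =>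
    h.of_leads_none (hfn k hk) (hstep ▸ leads_step v)
  constructor
  · rintro ⟨hr, hu⟩
    have hacyc : ¬ G.Leads T (G.other e v) v := fun h => by
      refine hr.not_mem_of_closed (P := fun w => G.Leads (Function.update T v (some e)) w v)
        ?_ ?_ v (Leads.refl v)
      · intro w hw
        by_cases hwv : w = v
        · rw [hwv, hstep]
          exact h.update hTv _
        · obtain ⟨n, hn⟩ := hw
          cases n with
          | zero => exact absurd hn hwv
          | succ n => exact ⟨n, hn⟩
      · intro w hw hwX
        exact hne w hwX (hw.eq_of_none (hfn w hwX)).symm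
    refine ⟨fun w => ?_, hacyc, ?_⟩
    · obtain ⟨k, hk, h⟩ := hr w
      rcases h.of_update with h | h
      · exact ⟨k, Finset.mem_insert_of_mem hk, h⟩
      · exact ⟨v, Finset.mem_insert_self _ _, h⟩
    · rcases hu.of_update with h | h
      · exact Or.inl h
      · refine Or.inr ⟨h, ?_⟩
        have := hnext j hj (hu.of_leads_none (hfn j hj) (h.update hTv _))
        exact this.of_update.resolve_right hacyc
  · rintro ⟨hr, hacyc, hu⟩
    have hvk : ∀ k, G.Leads T (G.other e v) k → G.Leads (Function.update T v (some e)) v k :=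
      fun k hk => leads_of_step (by rw [hstep]; exact hk.update hTv _)
    refine ⟨fun w => ?_, ?_⟩
    · obtain ⟨k, hk, h⟩ := hr w
      rcases Finset.mem_insert.1 hk with rfl | hk
      · obtain ⟨l, hl, hl'⟩ := hr (G.other e k)
        rcases Finset.mem_insert.1 hl with rfl | hl
        · exact absurd hl' hacyc
        · exact ⟨l, hl, (h.update hTv _).trans (hvk l hl')⟩
      · exact ⟨k, hk, h.update hTv _⟩
    · rcases hu with h | ⟨h, h'⟩
      · exact h.update hTv _
      · exact (h.update hTv _).trans (hvk j h')

/-- The weighted count of the forests rooted at `X` in which `u` belongs to the root `j`. -/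
def rootWeight (G : FeynmanGraph nV nE) (X : Finset (Fin nV)) (α : Fin nE → ℝ) (u j : Fin nV) : ℝ :=
  ∑ f ∈ (G.rootedFns X).filter fun f => G.Leads f u j, weight α f

/-- Removing the edge chosen at `v` expresses a sum over forests rooted at `X` through forests
rooted at `insert v X`. -/
theorem rootWeight_eq_sum_insert {X : Finset (Fin nV)} {v : Fin nV} (hv : v ∉ X)
    (α : Fin nE → ℝ) (u : Fin nV) {j : Fin nV} (hj : j ∈ X) :
    G.rootWeight X α u j = ∑ T ∈ G.rootedFns (insert v X), weight α T *
      ((if G.Leads T u j then 1 else 0) *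
          ∑ e ∈ G.star v, (if G.Leads T (G.other e v) v then 0 else α e) +
        (if G.Leads T u v then 1 else 0) *
          ∑ e ∈ G.star v, if G.Leads T (G.other e v) j then α e else 0) := by
  rw [rootWeight, rootedFns, Finset.filter_filter, Finset.sum_filter, sum_outFns_eq_sum_update hv,
    rootedFns, Finset.sum_filter]
  refine Finset.sum_congr rfl fun T hT => ?_
  have hTn : ∀ w ∈ insert v X, T w = none := (mem_outFns.1 hT).1
  have hTv : T v = none := hTn v (Finset.mem_insert_self _ _)
  have hexcl : ∀ w, G.Leads T w j → ¬ G.Leads T w v := fun w h h' =>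
    hv ((h.unique (hTn j (Finset.mem_insert_of_mem hj)) hTv h') ▸ hj)
  simp only [rooted_update_and_leads_iff hv hT _ hj, weight_update α hTv]
  split_ifs with hr h1 h2 h2
  · exact absurd h2 (hexcl _ h1)
  · simp only [hr, h1, h2, true_and, one_mul, zero_mul, add_zero]
    rw [Finset.mul_sum]
    refine Finset.sum_congr rfl fun e _ => ?_
    by_cases h : G.Leads T (G.other e v) v <;> simp [h, mul_comm]
  · simp only [hr, h1, h2, true_and, one_mul, zero_mul, zero_add, false_or]
    rw [Finset.mul_sum]
    refine Finset.sum_congr rfl fun e _ => ?_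
    by_cases h : G.Leads T (G.other e v) j
    · simp [h, hexcl _ h, mul_comm]
    · simp [h]
  · simp [h1, h2]
  · simp [hr]

/-- As a function of the vertex, `rootWeight` is harmonic outside the roots. -/
theorem sum_star_mul_rootWeight {X : Finset (Fin nV)} {v : Fin nV} (hv : v ∉ X)
    (α : Fin nE → ℝ) {j : Fin nV} (hj : j ∈ X) :
    ∑ e ∈ G.star v, α e * (G.rootWeight X α v j - G.rootWeight X α (G.other e v) j) = 0 := by
  have hexcl : ∀ T ∈ G.rootedFns (insert v X), ¬ G.Leads T v j := fun T hT h => by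
    have hTv := (mem_outFns.1 (mem_rootedFns.1 hT).1).1 v (Finset.mem_insert_self _ _)
    exact hv (h.eq_of_none hTv ▸ hj)
  simp only [mul_sub, Finset.sum_sub_distrib, ← Finset.sum_mul]
  simp only [rootWeight_eq_sum_insert hv α _ hj, Finset.mul_sum]
  rw [Finset.sum_comm (s := G.star v), ← Finset.sum_sub_distrib]
  refine Finset.sum_eq_zero fun T hT => ?_
  simp only [← Finset.mul_sum]
  rw [if_neg (hexcl T hT), if_pos (Leads.refl v)]
  set a := ∑ e ∈ G.star v, if G.Leads T (G.other e v) j then α e else 0 with ha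
  set b := ∑ e ∈ G.star v, if G.Leads T (G.other e v) v then 0 else α e with hb
  have hlin : ∀ p q : Fin nE → ℝ, ∑ e ∈ G.star v, α e * (weight α T * (p e * b + q e * a)) =
      weight α T * ((∑ e ∈ G.star v, α e * p e) * b + (∑ e ∈ G.star v, α e * q e) * a) := by
    intro p q
    rw [Finset.sum_mul, Finset.sum_mul, ← Finset.sum_add_distrib, Finset.mul_sum]
    exact Finset.sum_congr rfl fun e _ => by ring
  have hp : ∑ e ∈ G.star v, α e * (if G.Leads T (G.other e v) j then 1 else 0) = a := by
    simp only [ha, mul_ite, mul_one, mul_zero]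
  have hq : ∑ e ∈ G.star v, α e * (if G.Leads T (G.other e v) v then 1 else 0) =
      ∑ e ∈ G.star v, α e - b := by
    rw [hb, ← Finset.sum_sub_distrib]
    exact Finset.sum_congr rfl fun e _ => by split_ifs <;> simp
  rw [hlin, hp, hq]
  ring

/-- Adding an edge at the root `i` merges its tree into the one of `j`. -/
theorem rootWeight_erase {X : Finset (Fin nV)} {i j : Fin nV} (hi : i ∈ X) (hj : j ∈ X)
    (hij : i ≠ j) (α : Fin nE → ℝ) :
    G.rootWeight (X.erase i) α i j = ∑ e ∈ G.star i, α e * G.rootWeight X α (G.other e i) j := by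
  have hj' : j ∈ X.erase i := Finset.mem_erase.2 ⟨hij.symm, hj⟩
  rw [rootWeight_eq_sum_insert (Finset.notMem_erase i X) α i hj', Finset.insert_erase hi]
  have hexp : ∀ e ∈ G.star i, α e * G.rootWeight X α (G.other e i) j =
      ∑ T ∈ G.rootedFns X, weight α T * if G.Leads T (G.other e i) j then α e else 0 :=
    fun e _ => by
      rw [rootWeight, Finset.sum_filter, Finset.mul_sum]
      exact Finset.sum_congr rfl fun T _ => by split_ifs <;> ring
  rw [Finset.sum_congr rfl hexp, Finset.sum_comm]
  refine Finset.sum_congr rfl fun T hT => ?_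
  have hTi := (mem_outFns.1 (mem_rootedFns.1 hT).1).1 i hi
  have : ¬ G.Leads T i j := fun h => hij (h.eq_of_none hTi).symm
  rw [if_neg this, if_pos (Leads.refl i), zero_mul, zero_add, one_mul, Finset.mul_sum]

theorem rootWeight_root {X : Finset (Fin nV)} {i : Fin nV} (hi : i ∈ X) (α : Fin nE → ℝ)
    (j : Fin nV) :
    G.rootWeight X α i j = if i = j then ∑ f ∈ G.rootedFns X, weight α f else 0 := by
  rw [rootWeight, Finset.sum_filter]
  have : ∀ f ∈ G.rootedFns X, G.Leads f i j ↔ i = j := fun f hf =>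
    ⟨fun h => (h.eq_of_none ((mem_outFns.1 (mem_rootedFns.1 hf).1).1 i hi)).symm,
      fun h => h ▸ Leads.refl i⟩
  rw [Finset.sum_congr rfl fun f hf => by rw [this f hf]]
  split_ifs <;> simp

theorem sum_rootWeight (X : Finset (Fin nV)) (α : Fin nE → ℝ) (u : Fin nV) :
    ∑ j ∈ X, G.rootWeight X α u j = ∑ f ∈ G.rootedFns X, weight α f := by
  simp only [rootWeight, Finset.sum_filter]
  rw [Finset.sum_comm]
  refine Finset.sum_congr rfl fun f hf => ?_
  obtain ⟨hfo, hfr⟩ := mem_rootedFns.1 hf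
  obtain ⟨k, hk, h⟩ := hfr u
  rw [Finset.sum_eq_single_of_mem k hk, if_pos h]
  intro j hj hjk
  rw [if_neg fun h' => hjk (h'.unique ((mem_outFns.1 hfo).1 j hj) ((mem_outFns.1 hfo).1 k hk) h)]

theorem dualForestPoly_pairPart {i j : Fin nV} (hi : i ∈ G.ext) (hj : j ∈ G.ext) (hij : i ≠ j)
    (α : Fin nE → ℝ) :
    G.dualForestPoly (G.pairPart i j) α =
      ∑ e ∈ G.star i, α e * G.rootWeight G.ext α (G.other e i) j := by
  have hj' : j ∈ G.ext.erase i := Finset.mem_erase.2 ⟨hij.symm, hj⟩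
  rw [← rootWeight_erase hi hj hij, rootWeight]
  refine Eq.trans ?_ ((G.sum_forests_filter (G.ext.erase i)
    (fun F => (G.edgeGraph F).Reachable i j) α).trans (Finset.sum_congr ?_ fun _ _ => rfl))
  swap
  · ext f
    simp only [Finset.mem_filter]
    exact and_congr_right fun hf => reachable_iff_leads (mem_rootedFns.1 hf).1 hj'
  rw [dualForestPoly]
  congr 1
  ext F
  simp only [forests, Finset.mem_filter, Finset.mem_univ, true_and]
  have hc1 : ((G.ext.erase i).image fun v => ({v} : Finset (Fin nV))).card =
      (G.ext.erase i).card := Finset.card_image_of_injective _ Finset.singleton_injective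
  have hc2 : (G.pairPart i j).card = (G.ext.erase i).card := by
    rw [pairPart, Finset.card_insert_of_notMem,
      Finset.card_image_of_injective _ Finset.singleton_injective, Finset.card_erase_add_one hj']
    simp only [Finset.mem_image, not_exists, not_and]
    intro v _ hv
    have h1 : i ∈ ({v} : Finset (Fin nV)) := hv ▸ by simp
    have h2 : j ∈ ({v} : Finset (Fin nV)) := hv ▸ by simp
    exact hij ((Finset.mem_singleton.1 h1).trans (Finset.mem_singleton.1 h2).symm)
  rw [isForest_image_singleton]
  have hX := (G.ext.erase i).card_compl_add_card
  rw [Fintype.card_fin] at hX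
  rw [IsForest, hc2]
  have hrep : ∀ P, P ∈ G.pairPart i j ↔
      ∃ r ∈ G.ext.erase i, P = if r = j then {i, j} else {r} := by
    intro P
    simp only [pairPart, Finset.mem_insert, Finset.mem_image]
    constructor
    · rintro (rfl | ⟨r, hr, rfl⟩)
      · exact ⟨j, hj', by simp⟩
      · obtain ⟨hrj, hr⟩ := Finset.mem_erase.1 hr
        exact ⟨r, hr, by simp [hrj]⟩
    · rintro ⟨r, hr, rfl⟩
      by_cases hrj : r = j
      · simp [hrj]
      · exact Or.inr ⟨r, Finset.mem_erase.2 ⟨hrj, hr⟩, by simp [hrj]⟩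
  have hself : ∀ r, r ∈ if r = j then ({i, j} : Finset (Fin nV)) else {r} := fun r => by
    split_ifs with h <;> simp [h]
  constructor
  · rintro ⟨h1, h2, h3, h4⟩
    refine ⟨⟨by omega, h2, fun u hu v hv h => ?_⟩,
      h3 _ ((hrep _).2 ⟨j, hj', if_pos rfl |>.symm⟩) i (by simp) j (by simp)⟩
    by_contra huv
    refine h4 _ ((hrep _).2 ⟨u, hu, rfl⟩) _ ((hrep _).2 ⟨v, hv, rfl⟩) (fun hPQ => ?_)
      u (hself u) v (hself v) h
    have hvu := hPQ ▸ hself v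
    have hvi := Finset.ne_of_mem_erase hv
    split_ifs at hvu with huj
    · simp [hvi] at hvu
      exact huv (huj.trans hvu.symm)
    · exact huv (Finset.mem_singleton.1 hvu).symm
  · rintro ⟨⟨h1, h2, h3⟩, h4⟩
    have hroot : ∀ r, ∀ u ∈ (if r = j then ({i, j} : Finset (Fin nV)) else {r}),
        (G.edgeGraph F).Reachable u r := by
      intro r u hu
      split_ifs at hu with hrj
      · rw [hrj]
        rcases Finset.mem_insert.1 hu with rfl | hu
        · exact h4
        · rw [Finset.mem_singleton.1 hu]
      · rw [Finset.mem_singleton.1 hu]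
    refine ⟨by omega, h2, ?_, ?_⟩
    · intro P hP u hu v hv
      obtain ⟨r, -, rfl⟩ := (hrep P).1 hP
      exact (hroot r u hu).trans (hroot r v hv).symm
    · intro P hP Q hQ hPQ u hu v hv h
      obtain ⟨r, hr, rfl⟩ := (hrep P).1 hP
      obtain ⟨t, ht, rfl⟩ := (hrep Q).1 hQ
      exact hPQ (h3 r hr t ht ((hroot r u hu).symm.trans (h.trans (hroot t v hv))) ▸ rfl)

end FeynmanGraph

namespace FeynmanGraph

variable {nV nE : ℕ} {G : FeynmanGraph nV nE}

theorem sum_boundary_mul (e : Fin nE) (z : Fin nV → ℝ) :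
    ∑ v, G.boundary e v * z v = z (G.ends e).1 - z (G.ends e).2 := by
  simp [boundary, sub_mul, Finset.sum_sub_distrib, Pi.single_apply]

theorem assemble_of_mem {E : Type*} (x : Fin nV → E) (y : {v : Fin nV // v ∉ G.ext} → E)
    {v : Fin nV} (hv : v ∈ G.ext) : G.assemble x y v = x v := by
  simp [assemble, hv]

theorem assemble_of_notMem {E : Type*} (x : Fin nV → E) (y : {v : Fin nV // v ∉ G.ext} → E)
    {v : Fin nV} (hv : v ∉ G.ext) : G.assemble x y v = y ⟨v, hv⟩ := by
  simp [assemble, hv]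

theorem sum_boundary_mul_subtype (e : Fin nE) (y : {v : Fin nV // v ∉ G.ext} → ℝ) :
    ∑ v : {v : Fin nV // v ∉ G.ext}, G.boundary e v * y v =
      G.assemble 0 y (G.ends e).1 - G.assemble 0 y (G.ends e).2 := by
  rw [← sum_boundary_mul, ← Fintype.sum_subtype_add_sum_subtype (fun v => v ∉ G.ext)]
  rw [Finset.sum_eq_zero (s := (Finset.univ : Finset {v // ¬ v ∉ G.ext})), add_zero]
  · exact Finset.sum_congr rfl fun v _ => by rw [assemble_of_notMem _ _ v.2]
  · rintro ⟨v, hv⟩ -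
    simp [assemble_of_mem _ _ (not_not.1 hv)]

theorem dotProduct_reducedLaplacian_mulVec (α : Fin nE → ℝ) (y : {v : Fin nV // v ∉ G.ext} → ℝ) :
    y ⬝ᵥ (G.reducedLaplacian G.ext α).mulVec y =
      ∑ e, α e * (G.assemble 0 y (G.ends e).1 - G.assemble 0 y (G.ends e).2) ^ 2 := by
  simp only [← sum_boundary_mul_subtype, sq, Finset.mul_sum, dotProduct,
    Matrix.mulVec, reducedLaplacian, laplacian, Matrix.of_apply, Finset.sum_mul]
  rw [Finset.sum_comm (s := (Finset.univ : Finset (Fin nE)))]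
  refine Finset.sum_congr rfl fun v _ => ?_
  rw [Finset.sum_comm (s := (Finset.univ : Finset (Fin nE)))]
  exact Finset.sum_congr rfl fun w _ => Finset.sum_congr rfl fun e _ => by ring

theorem posDef_reducedLaplacian
    (hcomp : ∀ v : Fin nV, ∃ w ∈ G.ext, (G.edgeGraph Finset.univ).Reachable v w)
    {α : Fin nE → ℝ} (hα : ∀ e, 0 < α e) : (G.reducedLaplacian G.ext α).PosDef := by
  refine Matrix.PosDef.of_dotProduct_mulVec_pos ?_ fun y hy => ?_
  · ext v w
    simp only [Matrix.conjTranspose_apply, reducedLaplacian, laplacian, Matrix.of_apply,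
      star_trivial]
    exact Finset.sum_congr rfl fun e _ => by ring
  rw [star_trivial, dotProduct_reducedLaplacian_mulVec]
  have hnn : ∀ e ∈ Finset.univ,
      0 ≤ α e * (G.assemble 0 y (G.ends e).1 - G.assemble 0 y (G.ends e).2) ^ 2 :=
    fun e _ => mul_nonneg (hα e).le (sq_nonneg _)
  refine (Finset.sum_nonneg hnn).lt_of_ne' fun h0 => hy ?_
  have hends : ∀ e, G.assemble 0 y (G.ends e).1 = G.assemble 0 y (G.ends e).2 := fun e => by
    have := (Finset.sum_eq_zero_iff_of_nonneg hnn).1 h0 e (Finset.mem_univ e)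
    simpa [(hα e).ne', sub_eq_zero] using this
  have hadj : ∀ u v, (G.edgeGraph Finset.univ).Adj u v →
      G.assemble 0 y u = G.assemble 0 y v := fun u v h => by
    obtain ⟨e, -, he | he⟩ := edgeGraph_adj.1 h
    · simpa [he] using hends e
    · simpa [he] using (hends e).symm
  have hreach : ∀ u v, (G.edgeGraph Finset.univ).Reachable u v →
      G.assemble 0 y u = G.assemble 0 y v := by
    rintro u v ⟨p⟩
    induction p with
    | nil => rfl
    | cons h _ ih => exact (hadj _ _ h).trans ih
  funext v
  obtain ⟨w, hw, h⟩ := hcomp v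
  have := hreach v w h
  rwa [assemble_of_notMem _ _ v.2, assemble_of_mem _ _ hw] at this

theorem psiTilde_eq_det (α : Fin nE → ℝ) :
    G.psiTilde α = (G.reducedLaplacian G.ext α).det := by
  rw [psiTilde_eq_sum, det_reducedLaplacian]

theorem sum_sum_star (φ : Fin nV → Fin nE → ℝ) :
    ∑ v, ∑ e ∈ G.star v, φ v e = ∑ e, (φ (G.ends e).1 e + φ (G.ends e).2 e) := by
  simp only [star, Finset.sum_filter]
  rw [Finset.sum_comm]
  refine Finset.sum_congr rfl fun e _ => ?_
  rw [Fintype.sum_eq_add (G.ends e).1 (G.ends e).2 (G.ends_ne e)]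
  · simp [Incident]
  · rintro v ⟨h1, h2⟩
    simp [Incident, h1.symm, h2.symm]

section InnerProductSpace

variable {H : Type*} [NormedAddCommGroup H] [InnerProductSpace ℝ H]

theorem sum_inner_sub_sub (α : Fin nE → ℝ) (g k : Fin nV → H) :
    ∑ e, α e * inner ℝ (g (G.ends e).1 - g (G.ends e).2) (k (G.ends e).1 - k (G.ends e).2) =
      ∑ v, inner ℝ (g v) (∑ e ∈ G.star v, α e • (k v - k (G.other e v))) := by
  simp only [inner_sum, inner_smul_right]
  rw [sum_sum_star]
  refine Finset.sum_congr rfl fun e _ => ?_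
  have h1 : G.other e (G.ends e).1 = (G.ends e).2 := by simp [other]
  have h2 : G.other e (G.ends e).2 = (G.ends e).1 := by simp [other, G.ends_ne e]
  rw [h1, h2, inner_sub_left, ← neg_sub (k (G.ends e).1) (k (G.ends e).2), inner_neg_right]
  ring

/-- The energy of a configuration of vertex positions. -/
def energy (G : FeynmanGraph nV nE) (α : Fin nE → ℝ) (z : Fin nV → H) : ℝ :=
  ∑ e, α e * ‖z (G.ends e).1 - z (G.ends e).2‖ ^ 2

theorem energy_add {α : Fin nE → ℝ} {z : Fin nV → H}
    (hz : ∀ v ∉ G.ext, ∑ e ∈ G.star v, α e • (z v - z (G.other e v)) = 0)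
    (y : {v : Fin nV // v ∉ G.ext} → H) :
    G.energy α (z + G.assemble 0 y) = G.energy α z + G.energy α (G.assemble 0 y) := by
  have hcross := G.sum_inner_sub_sub α (G.assemble 0 y) z
  rw [Finset.sum_eq_zero (s := Finset.univ (α := Fin nV))] at hcross
  · have : ∀ e, α e * ‖(z + G.assemble 0 y) (G.ends e).1 - (z + G.assemble 0 y) (G.ends e).2‖ ^ 2 =
        α e * ‖z (G.ends e).1 - z (G.ends e).2‖ ^ 2 +
          α e * ‖G.assemble 0 y (G.ends e).1 - G.assemble 0 y (G.ends e).2‖ ^ 2 +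
        2 * (α e * inner ℝ (G.assemble 0 y (G.ends e).1 - G.assemble 0 y (G.ends e).2)
          (z (G.ends e).1 - z (G.ends e).2)) := fun e => by
      rw [Pi.add_apply, Pi.add_apply, add_sub_add_comm, norm_add_sq_real, real_inner_comm]
      ring
    simp only [energy, this, Finset.sum_add_distrib, ← Finset.mul_sum, hcross]
    ring
  · intro v _
    by_cases hv : v ∈ G.ext
    · simp [assemble_of_mem _ _ hv]
    · rw [hz v hv, inner_zero_right]

/-- The extension of the external positions `x` to the vertices of `G` that minimizes the
energy. -/
def harmonicExt (G : FeynmanGraph nV nE) (α : Fin nE → ℝ) (x : Fin nV → H) (v : Fin nV) : H :=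
  ∑ j ∈ G.ext, (G.rootWeight G.ext α v j / G.psiTilde α) • x j

theorem harmonicExt_of_mem {α : Fin nE → ℝ} (hΨ : G.psiTilde α ≠ 0) (x : Fin nV → H) {v : Fin nV}
    (hv : v ∈ G.ext) : G.harmonicExt α x v = x v := by
  simp only [harmonicExt, rootWeight_root hv, ← psiTilde_eq_sum]
  rw [Finset.sum_eq_single_of_mem v hv fun j _ hj => by simp [hj.symm], if_pos rfl, div_self hΨ,
    one_smul]

theorem sum_star_smul_harmonicExt (α : Fin nE → ℝ) (x : Fin nV → H) {v : Fin nV}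
    (hv : v ∉ G.ext) :
    ∑ e ∈ G.star v, α e • (G.harmonicExt α x v - G.harmonicExt α x (G.other e v)) = 0 := by
  simp only [harmonicExt, ← Finset.sum_sub_distrib, Finset.smul_sum, ← sub_smul, smul_smul]
  rw [Finset.sum_comm]
  refine Finset.sum_eq_zero fun j hj => ?_
  rw [← Finset.sum_smul]
  simp only [← sub_div, ← mul_div_assoc]
  rw [← Finset.sum_div, sum_star_mul_rootWeight hv α hj, zero_div, zero_smul]

theorem sum_mul_inner_sub_of_symm {ι : Type*} [LinearOrder ι] (S : Finset ι) {c : ι → ι → ℝ}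
    (hc : ∀ i j, c i j = c j i) (x : ι → H) :
    ∑ i ∈ S, ∑ j ∈ S, c i j * inner ℝ (x i) (x i - x j) =
      ∑ i ∈ S, ∑ j ∈ S with i < j, c i j * ‖x i - x j‖ ^ 2 := by
  have hsplit : ∀ i j, c i j * inner ℝ (x i) (x i - x j) =
      (if i < j then c i j * inner ℝ (x i) (x i - x j) else 0) +
        if j < i then c i j * inner ℝ (x i) (x i - x j) else 0 := fun i j => by
    rcases lt_trichotomy i j with h | rfl | h
    · simp [h, h.not_gt]
    · simp
    · simp [h, h.not_gt]
  simp only [Finset.sum_filter]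
  rw [Finset.sum_congr rfl fun i _ => Finset.sum_congr rfl fun j _ => hsplit i j]
  simp only [Finset.sum_add_distrib]
  rw [Finset.sum_comm (f := fun i j => if j < i then _ else _), ← Finset.sum_add_distrib]
  refine Finset.sum_congr rfl fun i _ => ?_
  rw [← Finset.sum_add_distrib]
  refine Finset.sum_congr rfl fun j _ => ?_
  split_ifs
  · rw [hc j i, ← real_inner_self_eq_norm_sq, inner_sub_left, ← neg_sub (x i) (x j),
      inner_neg_right]
    ring
  · simp

theorem pairPart_comm (i j : Fin nV) : G.pairPart i j = G.pairPart j i := by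
  rw [pairPart, pairPart, Finset.pair_comm, Finset.erase_right_comm]

theorem energy_harmonicExt {α : Fin nE → ℝ} (hΨ : G.psiTilde α ≠ 0) (x : Fin nV → H) :
    G.energy α (G.harmonicExt α x) = ∑ i ∈ G.ext, ∑ j ∈ G.ext with i < j,
      G.dualForestPoly (G.pairPart i j) α / G.psiTilde α * ‖x i - x j‖ ^ 2 := by
  rw [← sum_mul_inner_sub_of_symm G.ext
    (fun i j => by rw [pairPart_comm]) x]
  simp only [energy, ← real_inner_self_eq_norm_sq]
  rw [sum_inner_sub_sub, ← Finset.sum_subset (Finset.subset_univ G.ext) fun v _ hv => by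
    rw [sum_star_smul_harmonicExt α x hv, inner_zero_right]]
  refine Finset.sum_congr rfl fun i hi => ?_
  have hsub : ∀ u, x i - G.harmonicExt α x u =
      ∑ j ∈ G.ext, (G.rootWeight G.ext α u j / G.psiTilde α) • (x i - x j) := fun u => by
    simp only [smul_sub, Finset.sum_sub_distrib]
    rw [← Finset.sum_smul, ← Finset.sum_div, sum_rootWeight, ← psiTilde_eq_sum, div_self hΨ,
      one_smul, harmonicExt]
  simp only [harmonicExt_of_mem hΨ x hi, hsub, Finset.smul_sum, smul_smul]
  rw [Finset.sum_comm, inner_sum]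
  refine Finset.sum_congr rfl fun j hj => ?_
  rw [← Finset.sum_smul, inner_smul_right]
  by_cases hij : i = j
  · simp [hij]
  · rw [dualForestPoly_pairPart hi hj hij, Finset.sum_div]
    simp only [mul_div_assoc]

end InnerProductSpace

theorem energy_assemble {d : ℕ} (α : Fin nE → ℝ)
    (y : {v : Fin nV // v ∉ G.ext} → EuclideanSpace ℝ (Fin d)) :
    G.energy α (G.assemble 0 y) = ∑ k, (fun v => y v k) ⬝ᵥ
      (G.reducedLaplacian G.ext α).mulVec fun v => y v k := by
  simp only [dotProduct_reducedLaplacian_mulVec, energy, EuclideanSpace.norm_sq_eq,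
    Real.norm_eq_abs, sq_abs, Finset.mul_sum]
  rw [Finset.sum_comm]
  have : ∀ v k, G.assemble 0 y v k = G.assemble 0 (fun v => y v k) v := fun v k => by
    by_cases hv : v ∈ G.ext
    · simp [assemble_of_mem _ _ hv]
    · simp [assemble_of_notMem _ _ hv]
  simp only [PiLp.sub_apply, this]

theorem energy_assemble_add {d : ℕ} {α : Fin nE → ℝ} (hΨ : G.psiTilde α ≠ 0)
    (x : Fin nV → EuclideanSpace ℝ (Fin d))
    (y : {v : Fin nV // v ∉ G.ext} → EuclideanSpace ℝ (Fin d)) :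
    G.energy α (G.assemble x (y + fun v : {v // v ∉ G.ext} => G.harmonicExt α x v)) =
      G.phiTilde x α / G.psiTilde α + ∑ k, (fun v => y v k) ⬝ᵥ
        (G.reducedLaplacian G.ext α).mulVec fun v => y v k := by
  have hz : G.assemble x (y + fun v : {v // v ∉ G.ext} => G.harmonicExt α x v) =
      G.harmonicExt α x + G.assemble 0 y := by
    funext v
    by_cases hv : v ∈ G.ext
    · simp [assemble_of_mem _ _ hv, harmonicExt_of_mem hΨ x hv]
    · simp [assemble_of_notMem _ _ hv, add_comm]
  rw [hz, energy_add fun v hv => sum_star_smul_harmonicExt α x hv, energy_harmonicExt hΨ,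
    energy_assemble, phiTilde]
  simp only [Finset.sum_div]
  congr 1
  exact Finset.sum_congr rfl fun i _ => Finset.sum_congr rfl fun j _ => by ring

end FeynmanGraph

/-- Gaussian integration over the internal vertices: if every
connected component of `G` contains an external vertex and there is at least one
internal vertex, then for `α` in the open orthant and any external positions `x`,
`Ψ̃_G(α) > 0` and
`∫ ∏_{v internal} d^d x_v/π^{d/2} exp(-Σ_e α_e ‖x_{u(e)} - x_{w(e)}‖²)
  = Ψ̃_G(α)^{-d/2} exp(-Φ̃_G(α,x)/Ψ̃_G(α))`. -/
theorem gaussian_internal_integration {d nV nE : ℕ} (hd : 2 < d)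
    (G : FeynmanGraph nV nE)
    (hcomp : ∀ v : Fin nV, ∃ w ∈ G.ext, (G.edgeGraph Finset.univ).Reachable v w)
    (hint : G.intVerts.Nonempty)
    (α : Fin nE → ℝ) (hα : ∀ e, 0 < α e)
    (x : Fin nV → EuclideanSpace ℝ (Fin d)) :
    0 < G.psiTilde α ∧
    (∫⁻ y : {v : Fin nV // v ∉ G.ext} → EuclideanSpace ℝ (Fin d),
        ENNReal.ofReal (Real.exp (-∑ e, α e *
          ‖G.assemble x y (G.ends e).1 - G.assemble x y (G.ends e).2‖ ^ 2))) /
      ENNReal.ofReal (Real.pi ^ ((d : ℝ) / 2 * (G.intVerts.card : ℝ)))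
    = ENNReal.ofReal
        (G.psiTilde α ^ (-((d : ℝ) / 2)) * Real.exp (-(G.phiTilde x α) / G.psiTilde α)) := by
  have hA := FeynmanGraph.posDef_reducedLaplacian hcomp hα
  have hΨ : 0 < G.psiTilde α := by
    rw [FeynmanGraph.psiTilde_eq_det]
    exact hA.det_pos
  refine ⟨hΨ, ?_⟩
  have hpi : 0 < Real.pi ^ ((d : ℝ) / 2 * (G.intVerts.card : ℝ)) :=
    Real.rpow_pos_of_pos Real.pi_pos _
  have hcard : Fintype.card {v : Fin nV // v ∉ G.ext} = G.intVerts.card := by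
    rw [Fintype.card_subtype, FeynmanGraph.intVerts]
  have hfactor : ∀ y : {v : Fin nV // v ∉ G.ext} → EuclideanSpace ℝ (Fin d),
      ENNReal.ofReal (Real.exp
        (-G.energy α (G.assemble x (y + fun v : {v // v ∉ G.ext} => G.harmonicExt α x v)))) =
      ENNReal.ofReal (Real.exp (-(G.phiTilde x α) / G.psiTilde α)) *
        ENNReal.ofReal (Real.exp (-∑ k, (fun v => y v k) ⬝ᵥ
          (G.reducedLaplacian G.ext α).mulVec fun v => y v k)) := fun y => by
    rw [← ENNReal.ofReal_mul (Real.exp_pos _).le, ← Real.exp_add,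
      FeynmanGraph.energy_assemble_add hΨ.ne']
    congr 2
    ring
  change (∫⁻ y : {v : Fin nV // v ∉ G.ext} → EuclideanSpace ℝ (Fin d),
    ENNReal.ofReal (Real.exp (-G.energy α (G.assemble x y)))) / _ = _
  rw [← lintegral_add_right_eq_self _ fun v : {v : Fin nV // v ∉ G.ext} => G.harmonicExt α x v]
  simp only [hfactor]
  rw [lintegral_const_mul' _ _ ENNReal.ofReal_ne_top, hA.lintegral_exp_neg_euclideanSpace,
    hcard, ← ENNReal.ofReal_mul (Real.exp_pos _).le, ← ENNReal.ofReal_div_of_pos hpi,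
    FeynmanGraph.psiTilde_eq_det]
  congr 1
  field_simp
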